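/- arXiv:math/0403450 — 2 statements merged into one kernel-verified Lean document; each statement's English description precedes it below -/
import Mathlib

section
/- Let ε > 0, r ≥ 1 be an integer, and let (A, B) be an ε-uniform pair of disjoint vertex sets in a graph G with density d(A, B) = d. Then at least (1 − ε·φ(r))·C(|A|, r) of the r-element subsets R of A satisfy d̂_B(R) − d^r·|B| < ε·r·|B|, where φ(r) = r!·∑_{i=0}^{r−1} 1/i! and C(|A|, r) is the binomial coefficient. -/
open SimpleGraph Finset

/-- `φ(r) = r! ∑_{i=0}^{r-1} 1/i!`. -/
noncomputable def phi (r : ℕ) : ℝ :=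
  (Nat.factorial r : ℝ) * ∑ i ∈ Finset.range r, (1 : ℝ) / (Nat.factorial i : ℝ)

/-- The codegree `d̂_Y(R)`: the number of vertices of `Y` adjacent in `G` to
every vertex of `R`. -/
def codeg {V : Type*} (G : SimpleGraph V) [DecidableRel G.Adj]
    (Y : Finset V) (R : Finset V) : ℕ :=
  #(Y.filter fun y => ∀ r ∈ R, G.Adj y r)

lemma phi_nonneg (r : ℕ) : 0 ≤ phi r := by
  unfold phi; positivity

lemma phi_succ (r : ℕ) : phi (r + 1) = (r + 1) * (phi r + 1) := by
  have h : (r.factorial : ℝ) ≠ 0 := by positivity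
  unfold phi
  rw [Finset.sum_range_succ, Nat.factorial_succ]
  push_cast
  field_simp

/-- Every `(r + 1)`-set arises from `r + 1` pairs of an `r`-set and a new element. -/
lemma succ_mul_card_filter_powersetCard_le {V : Type*} [DecidableEq V] (A : Finset V) (r : ℕ)
    (P : Finset V → Prop) [DecidablePred P] :
    (r + 1) * #((A.powersetCard (r + 1)).filter P)
      ≤ ∑ R ∈ A.powersetCard r, #((A \ R).filter fun v => P (insert v R)) := by
  calc (r + 1) * #((A.powersetCard (r + 1)).filter P)
      = #(((A.powersetCard (r + 1)).filter P).sigma fun S => S) := by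
        rw [Finset.card_sigma, Finset.sum_congr rfl (g := fun _ => r + 1), Finset.sum_const,
          smul_eq_mul, mul_comm]
        intro S hS
        exact (Finset.mem_powersetCard.1 (Finset.mem_filter.1 hS).1).2
    _ ≤ #((A.powersetCard r).sigma fun R => (A \ R).filter fun v => P (insert v R)) := by
        refine Finset.card_le_card_of_injOn (fun p => ⟨p.1.erase p.2, p.2⟩) ?_ ?_
        · rintro ⟨S, v⟩ h
          simp only [Finset.coe_sigma, Set.mem_sigma_iff, Finset.mem_coe, Finset.mem_filter,
            Finset.mem_powersetCard, Finset.mem_sdiff] at h ⊢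
          obtain ⟨⟨⟨hSA, hS⟩, hP⟩, hv⟩ := h
          refine ⟨⟨(Finset.erase_subset _ _).trans hSA, ?_⟩, ⟨hSA hv, by simp⟩, ?_⟩
          · rw [Finset.card_erase_of_mem hv, hS, Nat.add_sub_cancel]
          · rwa [Finset.insert_erase hv]
        · rintro ⟨S, v⟩ h ⟨T, w⟩ h' heq
          simp only [Finset.coe_sigma, Set.mem_sigma_iff, Finset.mem_coe] at h h'
          simp only [Sigma.mk.injEq, heq_eq_eq] at heq
          obtain ⟨he, rfl⟩ := heq
          have : S = T := by
            rw [← Finset.insert_erase h.2, he, Finset.insert_erase h'.2]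
          rw [this]
    _ = _ := Finset.card_sigma _ _

section Uniform

variable {V : Type*} (G : SimpleGraph V) [DecidableRel G.Adj]

lemma codeg_insert [DecidableEq V] (B R : Finset V) (v : V) :
    codeg G B (insert v R) = #((B.filter fun y => ∀ u ∈ R, G.Adj y u).filter (G.Adj v)) := by
  unfold codeg
  rw [Finset.filter_filter]
  congr 1
  refine Finset.filter_congr fun y _ => ?_
  rw [Finset.forall_mem_insert, G.adj_comm v y, and_comm]

lemma codeg_empty (B : Finset V) : codeg G B ∅ = #B := by
  simp [codeg]

/-- Few vertices of a uniform pair have atypically large degree into a large subset. -/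
lemma SimpleGraph.IsUniform.card_filter_degree_lt {ε : ℝ} (hε : 0 < ε) {A B Y : Finset V}
    (hA : A.Nonempty) (hunif : G.IsUniform ε A B) (hYB : Y ⊆ B) (hY : Y.Nonempty)
    (hYcard : #B * ε ≤ #Y) :
    (#(A.filter fun v => (G.edgeDensity A B + ε) * #Y ≤ (#(Y.filter (G.Adj v)) : ℝ)) : ℝ)
      < ε * #A := by
  by_contra! h
  set X := A.filter fun v => (G.edgeDensity A B + ε) * #Y ≤ (#(Y.filter (G.Adj v)) : ℝ)
  have hYpos : (0 : ℝ) < #Y := by exact_mod_cast hY.card_pos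
  have hApos : (0 : ℝ) < #A := by exact_mod_cast hA.card_pos
  have hXpos : (0 : ℝ) < #X := lt_of_lt_of_le (by positivity) h
  have hu := (abs_lt.1 (hunif (Finset.filter_subset _ _ : X ⊆ A) hYB (by linarith) hYcard)).2
  have hedges : (#(G.interedges X Y) : ℝ) = ∑ v ∈ X, (#(Y.filter (G.Adj v)) : ℝ) := by
    have : #(G.interedges X Y) = ∑ v ∈ X, #(Y.filter (G.Adj v)) := by
      simp only [SimpleGraph.interedges, Rel.interedges, Finset.card_filter, Finset.sum_product]
    exact_mod_cast this
  have hlower : #X * ((G.edgeDensity A B + ε) * #Y) ≤ (#(G.interedges X Y) : ℝ) := by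
    rw [hedges, ← nsmul_eq_mul]
    exact Finset.card_nsmul_le_sum _ _ _ fun v hv => (Finset.mem_filter.1 hv).2
  have hdens : (G.edgeDensity X Y : ℝ) = #(G.interedges X Y) / (#X * #Y) := by
    rw [SimpleGraph.edgeDensity_def]; push_cast; rfl
  rw [hdens, sub_lt_iff_lt_add, div_lt_iff₀ (by positivity)] at hu
  nlinarith

/-- If the codegree of `R` is not too large, then few vertices `v` make the codegree of
`insert v R` too large. -/
lemma SimpleGraph.IsUniform.card_filter_codeg_insert_le [DecidableEq V] {ε : ℝ} (hε : 0 < ε)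
    {A B : Finset V} (hA : A.Nonempty) (hB : B.Nonempty) (hunif : G.IsUniform ε A B) (r : ℕ)
    (R : Finset V)
    (hR : (codeg G B R : ℝ) ≤ ((G.edgeDensity A B : ℝ) ^ r + ε * r) * #B) :
    (#(A.filter fun v => ((G.edgeDensity A B : ℝ) ^ (r + 1) + ε * (r + 1)) * #B
      ≤ (codeg G B (insert v R) : ℝ)) : ℝ) ≤ ε * #A := by
  simp only [codeg_insert]
  unfold codeg at hR
  set Y := B.filter fun y => ∀ u ∈ R, G.Adj y u
  have hd0 : (0 : ℝ) ≤ G.edgeDensity A B := by exact_mod_cast G.edgeDensity_nonneg A B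
  have hd1 : (G.edgeDensity A B : ℝ) ≤ 1 := by exact_mod_cast G.edgeDensity_le_one A B
  set d := (G.edgeDensity A B : ℝ) with hd
  have hBpos : (0 : ℝ) < #B := by exact_mod_cast hB.card_pos
  have hpow0 : 0 ≤ d ^ r := pow_nonneg hd0 r
  have hpow1 : d ^ r ≤ 1 := pow_le_one₀ hd0 hd1
  have hdeg (v : V) : (#(Y.filter (G.Adj v)) : ℝ) ≤ #Y := by
    exact_mod_cast Finset.card_filter_le _ _
  have hr0 : (0 : ℝ) ≤ r := r.cast_nonneg
  by_cases hsmall : (#Y : ℝ) < #B * ε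
  · rw [Finset.filter_false_of_mem]
    · simp only [Finset.card_empty, Nat.cast_zero]
      positivity
    · intro v _
      rw [not_le]
      refine (hdeg v).trans_lt (hsmall.trans_le ?_)
      rw [mul_comm]
      refine mul_le_mul_of_nonneg_right ?_ hBpos.le
      have : 0 ≤ d ^ (r + 1) := pow_nonneg hd0 _
      nlinarith [mul_nonneg hε.le hr0]
  · rw [not_lt] at hsmall
    have hYpos : (0 : ℝ) < #Y := lt_of_lt_of_le (by positivity) hsmall
    refine le_trans ?_ (hunif.card_filter_degree_lt G hε hA (Finset.filter_subset _ _ : Y ⊆ B)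
      (Finset.card_pos.1 (by exact_mod_cast hYpos)) hsmall).le
    rw [Nat.cast_le]
    refine Finset.card_le_card (Finset.monotone_filter_right _ fun v _ hv => ?_)
    by_contra! hlt
    have hv' := (hv.trans (hdeg v)).trans hR
    rw [← hd] at hlt
    have hv'' := hv.trans_lt hlt
    rw [pow_succ] at hv' hv''
    rcases le_or_gt (d + ε) 1 with h1 | h1
    · have h2 := hv''.trans_le (mul_le_mul_of_nonneg_left hR (by positivity))
      rw [← mul_assoc, mul_lt_mul_iff_left₀ hBpos] at h2
      nlinarith [mul_nonneg (mul_nonneg hε.le hr0) (sub_nonneg.2 h1),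
        mul_nonneg hε.le (sub_nonneg.2 hpow1)]
    · rw [mul_le_mul_iff_left₀ hBpos] at hv'
      nlinarith [mul_nonneg (sub_nonneg.2 hpow1) (sub_nonneg.2 hd1)]

/-- A bound on the number of `r`-sets of large codegree passes to `(r + 1)`-sets, with a weak
inequality becoming strict. -/
lemma SimpleGraph.IsUniform.card_filter_codeg_succ_le [DecidableEq V] {ε : ℝ} (hε : 0 < ε)
    {A B : Finset V} (hA : A.Nonempty) (hB : B.Nonempty) (hunif : G.IsUniform ε A B) (r : ℕ)
    (h : (#((A.powersetCard r).filter fun R =>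
      ((G.edgeDensity A B : ℝ) ^ r + ε * r) * #B < (codeg G B R : ℝ)) : ℝ)
        ≤ ε * phi r * (#A).choose r) :
    (#((A.powersetCard (r + 1)).filter fun R =>
      ((G.edgeDensity A B : ℝ) ^ (r + 1) + ε * (r + 1)) * #B ≤ (codeg G B R : ℝ)) : ℝ)
        ≤ ε * phi (r + 1) * (#A).choose (r + 1) := by
  rcases lt_or_ge (#A) (r + 1) with hAr | hAr
  · rw [Finset.powersetCard_eq_empty.2 hAr, Nat.choose_eq_zero_of_lt hAr]
    simp
  set d := (G.edgeDensity A B : ℝ) with hd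
  have hArR : (r : ℝ) + 1 ≤ #A := by exact_mod_cast hAr
  have hr0 : (0 : ℝ) ≤ r := r.cast_nonneg
  have hcount : ((r : ℝ) + 1) * (#((A.powersetCard (r + 1)).filter fun R =>
      (d ^ (r + 1) + ε * (r + 1)) * #B ≤ (codeg G B R : ℝ)) : ℝ)
      ≤ ∑ R ∈ A.powersetCard r, (#((A \ R).filter fun v =>
        (d ^ (r + 1) + ε * (r + 1)) * #B ≤ (codeg G B (insert v R) : ℝ)) : ℝ) := by
    exact_mod_cast succ_mul_card_filter_powersetCard_le A r _
  have hsum : ∑ R ∈ A.powersetCard r, (#((A \ R).filter fun v =>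
        (d ^ (r + 1) + ε * (r + 1)) * #B ≤ (codeg G B (insert v R) : ℝ)) : ℝ)
      ≤ ∑ R ∈ A.powersetCard r,
        ((if (d ^ r + ε * r) * #B < (codeg G B R : ℝ) then (#A - r : ℝ) else 0) + ε * #A) := by
    refine Finset.sum_le_sum fun R hR => ?_
    obtain ⟨hRA, hRr⟩ := Finset.mem_powersetCard.1 hR
    split_ifs with hlarge
    · have h1 : (#((A \ R).filter fun v =>
          (d ^ (r + 1) + ε * (r + 1)) * #B ≤ (codeg G B (insert v R) : ℝ)) : ℝ)
          ≤ #(A \ R) := by exact_mod_cast Finset.card_filter_le _ _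
      rw [Finset.card_sdiff_of_subset hRA, Nat.cast_sub (Finset.card_le_card hRA), hRr] at h1
      have : 0 ≤ ε * #A := by positivity
      linarith
    · rw [zero_add]
      refine le_trans ?_
        (hunif.card_filter_codeg_insert_le G hε hA hB r R (not_lt.1 hlarge))
      rw [Nat.cast_le]
      exact Finset.card_le_card (Finset.filter_subset_filter _ Finset.sdiff_subset)
  rw [Finset.sum_add_distrib, ← Finset.sum_filter, Finset.sum_const, Finset.sum_const,
    nsmul_eq_mul, nsmul_eq_mul, Finset.card_powersetCard] at hsum
  have hchoose : ((#A).choose (r + 1) : ℝ) * (r + 1) = (#A).choose r * (#A - r) := by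
    rw [← Nat.cast_sub (by omega : r ≤ #A)]
    exact_mod_cast Nat.choose_succ_right_eq (#A) r
  have hC : (0 : ℝ) ≤ ε * (#A).choose r := by positivity
  have hφ := phi_nonneg r
  have hbad := mul_le_mul_of_nonneg_right h (by linarith : (0 : ℝ) ≤ #A - r)
  have hratio : phi r * (#A - r) + #A ≤ (r + 1) * (phi r + 1) * (#A - r : ℝ) := by
    nlinarith [mul_nonneg hr0 (sub_nonneg.2 hArR),
      mul_nonneg (mul_nonneg hr0 hφ) (by linarith : (0 : ℝ) ≤ #A - r)]
  have hpos : (0 : ℝ) < r + 1 := by positivity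
  refine le_of_mul_le_mul_left ?_ hpos
  calc _ ≤ _ := hcount.trans hsum
    _ ≤ ε * (#A).choose r * (phi r * (#A - r) + #A) := by linarith
    _ ≤ ε * (#A).choose r * ((r + 1) * (phi r + 1) * (#A - r : ℝ)) :=
        mul_le_mul_of_nonneg_left hratio hC
    _ = ε * phi (r + 1) * ((#A).choose r * (#A - r)) := by rw [phi_succ]; ring
    _ = _ := by rw [← hchoose]; ring

lemma SimpleGraph.IsUniform.card_filter_codeg_le [DecidableEq V] {ε : ℝ} (hε : 0 < ε)
    {A B : Finset V} (hA : A.Nonempty) (hB : B.Nonempty) (hunif : G.IsUniform ε A B) (r : ℕ) :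
    (#((A.powersetCard r).filter fun R =>
      ((G.edgeDensity A B : ℝ) ^ r + ε * r) * #B < (codeg G B R : ℝ)) : ℝ)
        ≤ ε * phi r * (#A).choose r := by
  induction r with
  | zero => simp [Finset.filter_singleton, codeg_empty, phi]
  | succ r ih =>
    refine le_trans ?_ (hunif.card_filter_codeg_succ_le G hε hA hB r ih)
    rw [Nat.cast_le, Nat.cast_succ]
    exact Finset.card_le_card (Finset.monotone_filter_right _ fun R _ hR => hR.le)

end Uniform

/-- Let `ε > 0`, `r ≥ 1` and `(A, B)` be an `ε`-uniform pair with density `d`.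
Then at least `(1 − ε φ(r)) C(|A|, r)` `r`-sets `R ⊆ A` satisfy
`d̂_B(R) − d^r |B| < ε r |B|`. -/
theorem many_sets_codegree_upper {V : Type*} [DecidableEq V] (G : SimpleGraph V)
    [DecidableRel G.Adj] (ε : ℝ) (hε : 0 < ε) (r : ℕ) (hr : 1 ≤ r)
    (A B : Finset V) (hA : A.Nonempty) (hB : B.Nonempty) (hAB : Disjoint A B)
    (hunif : G.IsUniform ε A B) (d : ℝ) (hd : d = (G.edgeDensity A B : ℝ)) :
    (1 - ε * phi r) * ((#A).choose r : ℝ)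
      ≤ (#((A.powersetCard r).filter fun R =>
          (codeg G B R : ℝ) - d ^ r * (#B : ℝ) < ε * r * (#B : ℝ)) : ℝ) := by
  obtain ⟨k, rfl⟩ : ∃ k, r = k + 1 := ⟨r - 1, by omega⟩
  have hbad := hunif.card_filter_codeg_succ_le G hε hA hB k
    (hunif.card_filter_codeg_le G hε hA hB k)
  rw [← hd] at hbad
  have hsplit := Finset.card_filter_add_card_filter_not (s := A.powersetCard (k + 1))
    (fun R => (codeg G B R : ℝ) - d ^ (k + 1) * (#B : ℝ) < ε * (k + 1 : ℕ) * (#B : ℝ))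
  rw [Finset.card_powersetCard] at hsplit
  have hcongr : ((A.powersetCard (k + 1)).filter fun R =>
      ¬ (codeg G B R : ℝ) - d ^ (k + 1) * (#B : ℝ) < ε * (k + 1 : ℕ) * (#B : ℝ))
      = (A.powersetCard (k + 1)).filter fun R =>
        (d ^ (k + 1) + ε * (k + 1)) * #B ≤ (codeg G B R : ℝ) := by
    refine Finset.filter_congr fun R _ => ?_
    rw [not_lt, le_sub_iff_add_le, Nat.cast_succ, add_mul, add_comm]
  rw [hcongr] at hsplit
  rw [← hsplit] at hbad ⊢
  push_cast at hbad ⊢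
  linarith
end

section
/- Let ε > 0 and let (A₁, B) and (A₂, B) be ε-uniform pairs of disjoint vertex sets in a graph G, with densities d(A₁, B) = d₁ and d(A₂, B) = d₂, where A₁, A₂, B are pairwise disjoint. Then at least (1 − 2ε)·|A₁|·|A₂| of the pairs (u, v) ∈ A₁ × A₂ satisfy d̂_B({u, v}) − d₁·d₂·|B| < 2ε·|B|. -/
open SimpleGraph Finset

/-- In a uniform pair `(A, B)`, few vertices of `A` have many neighbours in a large subset `Y`
of `B`. -/
theorem SimpleGraph.IsUniform.card_filter_large_degree_lt {V : Type*} [DecidableEq V]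
    {G : SimpleGraph V} [DecidableRel G.Adj] {ε : ℝ} (hε : 0 < ε) {A B Y : Finset V}
    (hA : A.Nonempty) (hu : G.IsUniform ε A B) (hYB : Y ⊆ B) (hY : Y.Nonempty)
    (hYε : (#B : ℝ) * ε ≤ #Y) :
    (#{v ∈ A | ((G.edgeDensity A B : ℝ) + ε) * #Y ≤ #{y ∈ Y | G.Adj v y}} : ℝ) < #A * ε := by
  by_contra! h
  set S := {v ∈ A | ((G.edgeDensity A B : ℝ) + ε) * #Y ≤ #{y ∈ Y | G.Adj v y}}
  have hA0 : (0 : ℝ) < #A := by exact_mod_cast hA.card_pos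
  have hY0 : (0 : ℝ) < #Y := by exact_mod_cast hY.card_pos
  have hS0 : (0 : ℝ) < #S := (mul_pos hA0 hε).trans_le h
  have hunif := hu (filter_subset _ A) hYB h hYε
  have hedges : #(G.interedges S Y) = ∑ v ∈ S, #{y ∈ Y | G.Adj v y} := by
    rw [SimpleGraph.interedges, Rel.interedges, card_filter, sum_product]
    simp only [card_filter]
  have hle : (#S : ℝ) * (((G.edgeDensity A B : ℝ) + ε) * #Y) ≤ #(G.interedges S Y) := by
    rw [hedges, Nat.cast_sum, ← nsmul_eq_mul]
    exact card_nsmul_le_sum _ _ _ fun v hv ↦ (mem_filter.1 hv).2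
  have hdens : (G.edgeDensity A B : ℝ) + ε ≤ (G.edgeDensity S Y : ℝ) := by
    rw [SimpleGraph.edgeDensity_def G S Y]
    push_cast
    rw [le_div_iff₀ (by positivity)]
    linarith
  linarith [(abs_lt.1 hunif).2]

theorem codeg_pair {V : Type*} [DecidableEq V] (G : SimpleGraph V) [DecidableRel G.Adj]
    (B : Finset V) (u v : V) :
    codeg G B {u, v} = #{y ∈ {y ∈ B | G.Adj u y} | G.Adj v y} := by
  rw [codeg, filter_filter]
  congr 1
  ext y
  simp [G.adj_comm y]

/-- A vertex `u` whose degree into `B` is not too large has large codegree with only few vertices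
of `A`. -/
theorem SimpleGraph.IsUniform.card_filter_large_codeg_le {V : Type*} [DecidableEq V]
    {G : SimpleGraph V} [DecidableRel G.Adj] {ε : ℝ} (hε : 0 < ε) {A B : Finset V}
    (hA : A.Nonempty) (hB : B.Nonempty) (hu : G.IsUniform ε A B) {d : ℝ} (hd : 0 ≤ d) {u : V}
    (hdeg : (#{y ∈ B | G.Adj u y} : ℝ) ≤ (d + ε) * #B) :
    (#{v ∈ A | 2 * ε * (#B : ℝ) ≤
      (codeg G B {u, v} : ℝ) - d * (G.edgeDensity A B : ℝ) * #B} : ℝ) ≤ #A * ε := by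
  set N := {y ∈ B | G.Adj u y}
  set e : ℝ := (G.edgeDensity A B : ℝ) with he
  have hB0 : (0 : ℝ) < #B := by exact_mod_cast hB.card_pos
  have he0 : 0 ≤ e := Rat.cast_nonneg.2 (G.edgeDensity_nonneg A B)
  have he1 : e ≤ 1 := by
    rw [he]
    exact_mod_cast G.edgeDensity_le_one A B
  have hNB : (#N : ℝ) ≤ #B := by exact_mod_cast card_filter_le _ _
  rcases lt_or_ge (#N : ℝ) (#B * ε) with hsmall | hlarge
  · rw [filter_false_of_mem]
    · simp only [card_empty, Nat.cast_zero]
      positivity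
    · intro v _
      have hcodeg : (codeg G B {u, v} : ℝ) ≤ #N := by
        rw [codeg_pair]
        exact_mod_cast card_filter_le _ _
      have : 0 ≤ d * e * #B := by positivity
      nlinarith
  · have hN0 : N.Nonempty := by
      rw [← card_pos]
      exact_mod_cast (mul_pos hB0 hε).trans_le hlarge
    refine le_trans ?_ (hu.card_filter_large_degree_lt hε hA (filter_subset _ B) hN0 hlarge).le
    refine Nat.cast_le.2 (card_le_card (monotone_filter_right A fun v _ hv ↦ ?_))
    rw [codeg_pair] at hv
    have h₁ : e * #N ≤ e * ((d + ε) * #B) := mul_le_mul_of_nonneg_left hdeg he0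
    have h₂ : e * (ε * #B) ≤ 1 * (ε * #B) := mul_le_mul_of_nonneg_right he1 (by positivity)
    have h₃ : ε * #N ≤ ε * #B := mul_le_mul_of_nonneg_left hNB hε.le
    change (e + ε) * #N ≤ _
    linarith

/-- Let `ε > 0` and `(A₁, B)`, `(A₂, B)` be `ε`-uniform pairs with densities `d₁, d₂`,
where `A₁, A₂, B` are pairwise disjoint. Then at least `(1 − 2ε)|A₁||A₂|` pairs
`(u, v) ∈ A₁ × A₂` satisfy `d̂_B({u,v}) − d₁ d₂ |B| < 2ε |B|`. -/
theorem many_pairs_codegree_upper {V : Type*} [DecidableEq V] (G : SimpleGraph V)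
    [DecidableRel G.Adj] (ε : ℝ) (hε : 0 < ε)
    (A₁ A₂ B : Finset V) (hA₁ : A₁.Nonempty) (hA₂ : A₂.Nonempty) (hB : B.Nonempty)
    (h₁₂ : Disjoint A₁ A₂) (h₁B : Disjoint A₁ B) (h₂B : Disjoint A₂ B)
    (hu₁ : G.IsUniform ε A₁ B) (hu₂ : G.IsUniform ε A₂ B)
    (d₁ d₂ : ℝ) (hd₁ : d₁ = (G.edgeDensity A₁ B : ℝ)) (hd₂ : d₂ = (G.edgeDensity A₂ B : ℝ)) :
    (1 - 2 * ε) * (#A₁ : ℝ) * (#A₂ : ℝ)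
      ≤ (#((A₁ ×ˢ A₂).filter fun p =>
          (codeg G B {p.1, p.2} : ℝ) - d₁ * d₂ * (#B : ℝ) < 2 * ε * (#B : ℝ)) : ℝ) := by
  subst hd₁ hd₂
  rcases lt_or_ge 1 ε with hε1 | hε1
  · refine le_trans ?_ (Nat.cast_nonneg _)
    have : (0 : ℝ) ≤ #A₁ * #A₂ := by positivity
    nlinarith
  set d₁ : ℝ := (G.edgeDensity A₁ B : ℝ)
  set d₂ : ℝ := (G.edgeDensity A₂ B : ℝ)
  have hd₁0 : 0 ≤ d₁ := Rat.cast_nonneg.2 (G.edgeDensity_nonneg A₁ B)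
  have hB0 : (0 : ℝ) ≤ #B := Nat.cast_nonneg _
  set U := {u ∈ A₁ | (d₁ + ε) * #B ≤ #{y ∈ B | G.Adj u y}} with hU
  have hUcard : (#U : ℝ) < #A₁ * ε :=
    hu₁.card_filter_large_degree_lt hε hA₁ Subset.rfl hB (mul_le_of_le_one_right hB0 hε1)
  let bad (u : V) : Finset V :=
    {v ∈ A₂ | 2 * ε * (#B : ℝ) ≤ (codeg G B {u, v} : ℝ) - d₁ * d₂ * #B}
  have hbad : ∀ u ∈ A₁, (#(bad u) : ℝ) ≤ (if u ∈ U then (#A₂ : ℝ) else 0) + #A₂ * ε := by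
    intro u hu
    split_ifs with huU
    · have : (#(bad u) : ℝ) ≤ #A₂ := by exact_mod_cast card_filter_le _ _
      have : (0 : ℝ) ≤ #A₂ * ε := by positivity
      linarith
    · rw [zero_add]
      refine hu₂.card_filter_large_codeg_le hε hA₂ hB hd₁0 ?_
      by_contra! h
      exact huU (mem_filter.2 ⟨hu, h.le⟩)
  have hsum : (∑ u ∈ A₁, (#(bad u) : ℝ)) ≤ #U * #A₂ + #A₁ * (#A₂ * ε) := by
    refine (sum_le_sum hbad).trans_eq ?_
    rw [sum_add_distrib, ← sum_filter, filter_mem_eq_inter,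
      inter_eq_right.2 (filter_subset _ A₁)]
    simp [hU]
  have hcompl := card_filter_add_card_filter_not (s := A₁ ×ˢ A₂) fun p : V × V ↦
    (codeg G B {p.1, p.2} : ℝ) - d₁ * d₂ * (#B : ℝ) < 2 * ε * (#B : ℝ)
  have hbadcard : #{p ∈ A₁ ×ˢ A₂ |
      ¬ (codeg G B {p.1, p.2} : ℝ) - d₁ * d₂ * (#B : ℝ) < 2 * ε * (#B : ℝ)} =
      ∑ u ∈ A₁, #(bad u) := by
    rw [card_filter, sum_product]
    simp only [bad, card_filter, not_lt]
  rw [hbadcard, card_product] at hcompl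
  have hcompl' := congrArg (Nat.cast : ℕ → ℝ) hcompl
  push_cast at hcompl'
  have hUA : (#U : ℝ) * #A₂ ≤ #A₁ * ε * #A₂ :=
    mul_le_mul_of_nonneg_right hUcard.le (Nat.cast_nonneg _)
  linarith
end
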